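/- (Chern's affine Bernstein conjecture, n = 2.) Let f be a smooth, strictly convex function defined for all (x₁,x₂) ∈ ℝ². If f satisfies the affine maximal surface equation ∑_{i,j=1}^{2} F^{ij} ∂²w/∂x_i∂x_j = 0 with w := [det(∂²f/∂x_i∂x_j)]^{−3/4} on all of ℝ², then f is a quadratic polynomial (i.e. its graph is an elliptic paraboloid). -/

import Mathlib

open Real Filter Topology Matrix

noncomputable section

/-- The `i`-th partial derivative of `f`. -/
def pd {n : ℕ} (i : Fin n) (f : (Fin n → ℝ) → ℝ) : (Fin n → ℝ) → ℝ :=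
  fun x => fderiv ℝ f x (Pi.single i 1)

/-- The Hessian matrix `(∂²f/∂x_i∂x_j)` of `f` at `x`. -/
def hess {n : ℕ} (f : (Fin n → ℝ) → ℝ) (x : Fin n → ℝ) : Matrix (Fin n) (Fin n) ℝ :=
  Matrix.of fun i j => pd i (pd j f) x

/-- The gradient vector of `f` at `x`. -/
def gradv {n : ℕ} (f : (Fin n → ℝ) → ℝ) (x : Fin n → ℝ) : Fin n → ℝ :=
  fun i => pd i f x

/-- `ρ := (det (f_ij))^(-1/(n+2))`. -/
def rho {n : ℕ} (f : (Fin n → ℝ) → ℝ) (x : Fin n → ℝ) : ℝ :=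
  (hess f x).det ^ (-(1 : ℝ) / ((n : ℝ) + 2))

/-- The squared norm `‖grad h‖² = ∑ f^{ij} h_i h_j` with respect to the Calabi metric of `f`. -/
def gradSq {n : ℕ} (f h : (Fin n → ℝ) → ℝ) (x : Fin n → ℝ) : ℝ :=
  ∑ i, ∑ j, (hess f x)⁻¹ i j * pd i h x * pd j h x

/-- The Laplacian `Δh = (1/√det)(∑ ∂_i(√det · f^{ij} ∂_j h))` with respect to the
Calabi metric of `f`. -/
def calabiLap {n : ℕ} (f h : (Fin n → ℝ) → ℝ) (x : Fin n → ℝ) : ℝ :=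
  (Real.sqrt (hess f x).det)⁻¹ *
    ∑ i, ∑ j, pd i (fun y => Real.sqrt (hess f y).det * (hess f y)⁻¹ i j * pd j h y) x

/-- `Φ := ‖grad ρ‖²/ρ²`. -/
def Phi {n : ℕ} (f : (Fin n → ℝ) → ℝ) (x : Fin n → ℝ) : ℝ :=
  gradSq f (rho f) x / (rho f x) ^ 2

/-- PDE (1.2): `Δρ = -β ‖grad ρ‖²/ρ` on `Ω`. -/
def PDE2 {n : ℕ} (f : (Fin n → ℝ) → ℝ) (β : ℝ) (Ω : Set (Fin n → ℝ)) : Prop :=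
  ∀ x ∈ Ω, calabiLap f (rho f) x = -β * gradSq f (rho f) x / rho f x

/-- The cofactor matrix of a square matrix. -/
def cof {n : ℕ} (H : Matrix (Fin n) (Fin n) ℝ) : Matrix (Fin n) (Fin n) ℝ :=
  (Matrix.adjugate H)ᵀ

/-- PDE (1.1): `∑ F^{ij} w_ij = 0` with `w = (det (f_ij))^a` on `Ω`, where `(F^{ij})`
is the cofactor matrix of the Hessian of `f`. -/
def PDE1 {n : ℕ} (f : (Fin n → ℝ) → ℝ) (a : ℝ) (Ω : Set (Fin n → ℝ)) : Prop :=
  ∀ x ∈ Ω, ∑ i, ∑ j,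
    cof (hess f x) i j * pd i (pd j fun y => (hess f y).det ^ a) x = 0

/-- `f` is a quadratic polynomial on `ℝ²`. -/
def IsQuadratic (f : (Fin 2 → ℝ) → ℝ) : Prop :=
  ∃ (Q : Matrix (Fin 2) (Fin 2) ℝ) (b : Fin 2 → ℝ) (c : ℝ),
    ∀ x, f x = (∑ i, ∑ j, Q i j * x i * x j) + (∑ i, b i * x i) + c

/-- Euclidean open ball of radius `r` centered at `0` in `ℝ²`. -/
def ebal (r : ℝ) : Set (Fin 2 → ℝ) := {x | (x 0) ^ 2 + (x 1) ^ 2 < r ^ 2}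

/-- Euclidean norm on `ℝ²`. -/
def enorm2 (x : Fin 2 → ℝ) : ℝ := Real.sqrt ((x 0) ^ 2 + (x 1) ^ 2)

/-- A normalized convex domain: `B_{2^{-3/2}}(0) ⊆ Ω ⊆ B_1(0)`. -/
def NormalizedDomain (Ω : Set (Fin 2 → ℝ)) : Prop :=
  IsOpen Ω ∧ Convex ℝ Ω ∧ ebal ((2 : ℝ) ^ (-(3 : ℝ) / 2)) ⊆ Ω ∧ Ω ⊆ ebal 1

/-- The class `𝒮(Ω,C)`: smooth strictly convex functions on `Ω` with `inf f = 0` and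
`f = C` on `∂Ω`. -/
def SClass (Ω : Set (Fin 2 → ℝ)) (C : ℝ) (f : (Fin 2 → ℝ) → ℝ) : Prop :=
  ContDiffOn ℝ (⊤ : ℕ∞) f Ω ∧ (∀ x ∈ Ω, (hess f x).PosDef) ∧
    sInf (f '' Ω) = 0 ∧ ContinuousOn f (closure Ω) ∧ ∀ x ∈ frontier Ω, f x = C

/-- `u` is the Legendre transform function of `f` relative to `0`:
`u(∇f(x)) = ⟨x, ∇f(x)⟩ - f(x)`. -/
def LegendreOf (Ω : Set (Fin 2 → ℝ)) (f u : (Fin 2 → ℝ) → ℝ) : Prop :=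
  ∀ x ∈ Ω, u (gradv f x) = (∑ i, x i * gradv f x i) - f x

end

/-- The linear form `(u, v) ↦ a u + b v` on `ℝ²`. -/
def linForm (a b : ℝ) : (Fin 2 → ℝ) →L[ℝ] ℝ :=
  a • ContinuousLinearMap.proj 0 + b • ContinuousLinearMap.proj 1

@[simp]
theorem linForm_apply (a b : ℝ) (u : Fin 2 → ℝ) : linForm a b u = a * u 0 + b * u 1 := by
  simp [linForm]

theorem eq_linForm (l : (Fin 2 → ℝ) →L[ℝ] ℝ) :
    l = linForm (l (Pi.single 0 1)) (l (Pi.single 1 1)) := by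
  ext u
  have hu : u = u 0 • Pi.single 0 1 + u 1 • Pi.single 1 1 := by
    ext i
    fin_cases i <;> simp
  conv_lhs => rw [hu]
  simp only [map_add, map_smul, linForm_apply, smul_eq_mul]
  ring

/-- The function `φ` on `ℝ²` is twice differentiable at `x`, with gradient `(g₀, g₁)` and
symmetric Hessian `(h₀₀, h₀₁; h₀₁, h₁₁)` there. -/
def HasJet (φ : (Fin 2 → ℝ) → ℝ) (x : Fin 2 → ℝ) (g₀ g₁ h₀₀ h₀₁ h₁₁ : ℝ) : Prop :=
  ∃ G₀ G₁ : (Fin 2 → ℝ) → ℝ,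
    (∀ᶠ y in 𝓝 x, HasFDerivAt φ (linForm (G₀ y) (G₁ y)) y) ∧
    HasFDerivAt G₀ (linForm h₀₀ h₀₁) x ∧ HasFDerivAt G₁ (linForm h₀₁ h₁₁) x ∧
    G₀ x = g₀ ∧ G₁ x = g₁

namespace HasJet

variable {φ χ : (Fin 2 → ℝ) → ℝ} {x : Fin 2 → ℝ}
  {g₀ g₁ h₀₀ h₀₁ h₁₁ k₀ k₁ l₀₀ l₀₁ l₁₁ : ℝ}

theorem congr_jet (h : HasJet φ x g₀ g₁ h₀₀ h₀₁ h₁₁) (e₀ : g₀ = k₀) (e₁ : g₁ = k₁)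
    (e₀₀ : h₀₀ = l₀₀) (e₀₁ : h₀₁ = l₀₁) (e₁₁ : h₁₁ = l₁₁) :
    HasJet φ x k₀ k₁ l₀₀ l₀₁ l₁₁ := by
  subst e₀ e₁ e₀₀ e₀₁ e₁₁
  exact h

theorem continuousAt (h : HasJet φ x g₀ g₁ h₀₀ h₀₁ h₁₁) : ContinuousAt φ x := by
  obtain ⟨G₀, G₁, hφ, -⟩ := h
  exact hφ.self_of_nhds.continuousAt

theorem hasFDerivAt (h : HasJet φ x g₀ g₁ h₀₀ h₀₁ h₁₁) : HasFDerivAt φ (linForm g₀ g₁) x := by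
  obtain ⟨G₀, G₁, hφ, -, -, rfl, rfl⟩ := h
  exact hφ.self_of_nhds

theorem add (h : HasJet φ x g₀ g₁ h₀₀ h₀₁ h₁₁) (h' : HasJet χ x k₀ k₁ l₀₀ l₀₁ l₁₁) :
    HasJet (fun y => φ y + χ y) x (g₀ + k₀) (g₁ + k₁) (h₀₀ + l₀₀) (h₀₁ + l₀₁) (h₁₁ + l₁₁) := by
  obtain ⟨G₀, G₁, hφ, hG₀, hG₁, rfl, rfl⟩ := h
  obtain ⟨K₀, K₁, hχ, hK₀, hK₁, rfl, rfl⟩ := h'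
  refine ⟨fun y => G₀ y + K₀ y, fun y => G₁ y + K₁ y, ?_, ?_, ?_, rfl, rfl⟩
  · filter_upwards [hφ, hχ] with y h₁ h₂
    refine (h₁.add h₂).congr_fderiv ?_
    ext u
    simp
    ring
  · refine (hG₀.add hK₀).congr_fderiv ?_
    ext u
    simp
    ring
  · refine (hG₁.add hK₁).congr_fderiv ?_
    ext u
    simp
    ring

theorem mul (h : HasJet φ x g₀ g₁ h₀₀ h₀₁ h₁₁) (h' : HasJet χ x k₀ k₁ l₀₀ l₀₁ l₁₁) :
    HasJet (fun y => φ y * χ y) x (φ x * k₀ + χ x * g₀) (φ x * k₁ + χ x * g₁)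
      (φ x * l₀₀ + 2 * g₀ * k₀ + χ x * h₀₀) (φ x * l₀₁ + g₀ * k₁ + g₁ * k₀ + χ x * h₀₁)
      (φ x * l₁₁ + 2 * g₁ * k₁ + χ x * h₁₁) := by
  obtain ⟨G₀, G₁, hφ, hG₀, hG₁, rfl, rfl⟩ := h
  obtain ⟨K₀, K₁, hχ, hK₀, hK₁, rfl, rfl⟩ := h'
  refine ⟨fun y => φ y * K₀ y + χ y * G₀ y, fun y => φ y * K₁ y + χ y * G₁ y,
    ?_, ?_, ?_, rfl, rfl⟩
  · filter_upwards [hφ, hχ] with y h₁ h₂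
    refine (h₁.mul h₂).congr_fderiv ?_
    ext u
    simp
    ring
  · refine ((hφ.self_of_nhds.mul hK₀).add (hχ.self_of_nhds.mul hG₀)).congr_fderiv ?_
    ext u
    simp
    ring
  · refine ((hφ.self_of_nhds.mul hK₁).add (hχ.self_of_nhds.mul hG₁)).congr_fderiv ?_
    ext u
    simp
    ring

theorem comp {ψ ψ' : ℝ → ℝ} {ψ'' : ℝ} (hψ : ∀ᶠ τ in 𝓝 (φ x), HasDerivAt ψ (ψ' τ) τ)
    (hψ' : HasDerivAt ψ' ψ'' (φ x)) (h : HasJet φ x g₀ g₁ h₀₀ h₀₁ h₁₁) :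
    HasJet (fun y => ψ (φ y)) x (ψ' (φ x) * g₀) (ψ' (φ x) * g₁)
      (ψ'' * g₀ * g₀ + ψ' (φ x) * h₀₀) (ψ'' * g₀ * g₁ + ψ' (φ x) * h₀₁)
      (ψ'' * g₁ * g₁ + ψ' (φ x) * h₁₁) := by
  have hc := h.continuousAt
  obtain ⟨G₀, G₁, hφ, hG₀, hG₁, rfl, rfl⟩ := h
  have hψφ := hψ'.comp_hasFDerivAt x hφ.self_of_nhds
  refine ⟨fun y => ψ' (φ y) * G₀ y, fun y => ψ' (φ y) * G₁ y, ?_, ?_, ?_, rfl, rfl⟩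
  · filter_upwards [hφ, hc.eventually hψ] with y h₁ h₂
    refine (h₂.comp_hasFDerivAt y h₁).congr_fderiv ?_
    ext u
    simp
    ring
  · refine (hψφ.mul hG₀).congr_fderiv ?_
    ext u
    simp
    ring
  · refine (hψφ.mul hG₁).congr_fderiv ?_
    ext u
    simp
    ring

theorem const (c : ℝ) (x : Fin 2 → ℝ) : HasJet (fun _ => c) x 0 0 0 0 0 := by
  have h0 : ∀ (c : ℝ) (y : Fin 2 → ℝ), HasFDerivAt (fun _ => c) (linForm 0 0) y := fun c y =>
    (hasFDerivAt_const c y).congr_fderiv (by ext u; simp)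
  exact ⟨fun _ => 0, fun _ => 0, .of_forall (h0 c), h0 0 x, h0 0 x, rfl, rfl⟩

theorem const_mul (c : ℝ) (h : HasJet φ x g₀ g₁ h₀₀ h₀₁ h₁₁) :
    HasJet (fun y => c * φ y) x (c * g₀) (c * g₁) (c * h₀₀) (c * h₀₁) (c * h₁₁) :=
  ((const c x).mul h).congr_jet (by ring) (by ring) (by ring) (by ring) (by ring)

theorem affine (a b c : ℝ) (x : Fin 2 → ℝ) :
    HasJet (fun y => a * y 0 + b * y 1 + c) x a b 0 0 0 := by
  have h0 : ∀ (c : ℝ) (y : Fin 2 → ℝ), HasFDerivAt (fun _ => c) (linForm 0 0) y := fun c y =>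
    (hasFDerivAt_const c y).congr_fderiv (by ext u; simp)
  refine ⟨fun _ => a, fun _ => b, .of_forall fun y => ?_, h0 a x, h0 b x, rfl, rfl⟩
  simpa using (linForm a b).hasFDerivAt (x := y) |>.add_const c

theorem log (hx : 0 < φ x) (h : HasJet φ x g₀ g₁ h₀₀ h₀₁ h₁₁) :
    HasJet (fun y => Real.log (φ y)) x ((φ x)⁻¹ * g₀) ((φ x)⁻¹ * g₁)
      (-(φ x ^ 2)⁻¹ * g₀ * g₀ + (φ x)⁻¹ * h₀₀) (-(φ x ^ 2)⁻¹ * g₀ * g₁ + (φ x)⁻¹ * h₀₁)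
      (-(φ x ^ 2)⁻¹ * g₁ * g₁ + (φ x)⁻¹ * h₁₁) :=
  comp ((eventually_gt_nhds hx).mono fun _ ht => Real.hasDerivAt_log ht.ne')
    (hasDerivAt_inv hx.ne') h

theorem pd_eq (h : HasJet φ x g₀ g₁ h₀₀ h₀₁ h₁₁) : pd 0 φ x = g₀ ∧ pd 1 φ x = g₁ := by
  obtain ⟨G₀, G₁, hφ, -, -, rfl, rfl⟩ := h
  simp [pd, hφ.self_of_nhds.fderiv]

theorem pd_pd_eq (h : HasJet φ x g₀ g₁ h₀₀ h₀₁ h₁₁) :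
    pd 0 (pd 0 φ) x = h₀₀ ∧ pd 0 (pd 1 φ) x = h₀₁ ∧ pd 1 (pd 0 φ) x = h₀₁ ∧
      pd 1 (pd 1 φ) x = h₁₁ := by
  obtain ⟨G₀, G₁, hφ, hG₀, hG₁, -⟩ := h
  have e₀ : pd 0 φ =ᶠ[𝓝 x] G₀ := hφ.mono fun y hy => by simp [pd, hy.fderiv]
  have e₁ : pd 1 φ =ᶠ[𝓝 x] G₁ := hφ.mono fun y hy => by simp [pd, hy.fderiv]
  have d₀ := (hG₀.congr_of_eventuallyEq e₀).fderiv
  have d₁ := (hG₁.congr_of_eventuallyEq e₁).fderiv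
  refine ⟨?_, ?_, ?_, ?_⟩ <;> rw [pd] <;> simp [d₀, d₁]

theorem of_isLocalMin (h : HasJet φ x g₀ g₁ h₀₀ h₀₁ h₁₁) (hmin : IsLocalMin φ x) :
    g₀ = 0 ∧ g₁ = 0 ∧ ∀ α β : ℝ, 0 ≤ α ^ 2 * h₀₀ + 2 * α * β * h₀₁ + β ^ 2 * h₁₁ := by
  obtain ⟨G₀, G₁, hφ, hG₀, hG₁, rfl, rfl⟩ := h
  have hz := hmin.hasFDerivAt_eq_zero hφ.self_of_nhds
  have z₀ : G₀ x = 0 := by simpa using congrArg (fun l => l (Pi.single 0 1)) hz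
  have z₁ : G₁ x = 0 := by simpa using congrArg (fun l => l (Pi.single 1 1)) hz
  refine ⟨z₀, z₁, fun α β => ?_⟩
  by_contra! hneg
  set d : Fin 2 → ℝ := ![α, β] with hd
  set γ : ℝ → Fin 2 → ℝ := fun τ => x + τ • d with hγ
  have hγ0 : γ 0 = x := by simp [hγ]
  have hγd : ∀ τ, HasDerivAt γ d τ := fun τ => by
    simpa [hγ] using ((hasDerivAt_id τ).smul_const d).const_add x
  have hγc : Tendsto γ (𝓝 0) (𝓝 x) := by simpa [hγ0] using (hγd 0).continuousAt.tendsto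
  have hg : ∀ᶠ τ in 𝓝 (0 : ℝ), HasDerivAt (φ ∘ γ) (G₀ (γ τ) * α + G₁ (γ τ) * β) τ := by
    filter_upwards [hγc.eventually hφ] with τ hτ
    simpa [hd] using hτ.comp_hasDerivAt τ (hγd τ)
  have hg' : deriv (φ ∘ γ) =ᶠ[𝓝 0] fun τ => G₀ (γ τ) * α + G₁ (γ τ) * β :=
    hg.mono fun τ hτ => hτ.deriv
  have hG : HasDerivAt (deriv (φ ∘ γ)) (α ^ 2 * h₀₀ + 2 * α * β * h₀₁ + β ^ 2 * h₁₁) 0 := by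
    rw [← hγ0] at hG₀ hG₁
    have := ((hG₀.comp_hasDerivAt 0 (hγd 0)).mul_const α).add
      ((hG₁.comp_hasDerivAt 0 (hγd 0)).mul_const β)
    refine HasDerivAt.congr_of_eventuallyEq (this.congr_deriv ?_) hg'
    simp [hd]
    ring
  have hmin' : ∀ᶠ τ in 𝓝 (0 : ℝ), φ x ≤ φ (γ τ) := hγc.eventually hmin
  have hmax : IsLocalMax (φ ∘ γ) 0 := by
    refine isLocalMax_of_deriv_deriv_neg (by rwa [hG.deriv]) ?_
      hg.self_of_nhds.continuousAt
    rw [hg.self_of_nhds.deriv, hγ0, z₀, z₁]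
    simp
  have hconst : φ ∘ γ =ᶠ[𝓝 0] fun _ => φ x := by
    filter_upwards [hmin', hmax] with τ h₁ h₂
    simp only [Function.comp, hγ0] at h₂ ⊢
    exact le_antisymm h₂ h₁
  have h0 : deriv (φ ∘ γ) =ᶠ[𝓝 0] fun _ => 0 := by
    simpa using hconst.deriv
  have h1 := h0.deriv_eq
  rw [hG.deriv] at h1
  simp at h1
  linarith

/-- At a local minimum, the contraction of the Hessian with a positive definite matrix is
nonnegative. -/
theorem contract_nonneg_of_isLocalMin (h : HasJet φ x g₀ g₁ h₀₀ h₀₁ h₁₁)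
    (hmin : IsLocalMin φ x) {r σ t : ℝ} (hr : 0 < r) (hD : 0 < r * t - σ ^ 2) :
    0 ≤ t * h₀₀ - 2 * σ * h₀₁ + r * h₁₁ := by
  obtain ⟨-, -, hq⟩ := h.of_isLocalMin hmin
  have h₁ := hq (-σ) r
  have h₂ := mul_nonneg hD.le (hq 1 0)
  refine nonneg_of_mul_nonneg_right (a := r) ?_ hr
  linarith

end HasJet

theorem contDiff_pd {φ : (Fin 2 → ℝ) → ℝ} (h : ContDiff ℝ (⊤ : ℕ∞) φ) (i : Fin 2) :
    ContDiff ℝ (⊤ : ℕ∞) (pd i φ) :=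
  (h.fderiv_right (m := (⊤ : ℕ∞)) (by simp)).clm_apply contDiff_const

theorem hasFDerivAt_of_contDiff {φ : (Fin 2 → ℝ) → ℝ} (h : ContDiff ℝ (⊤ : ℕ∞) φ)
    (x : Fin 2 → ℝ) : HasFDerivAt φ (linForm (pd 0 φ x) (pd 1 φ x)) x :=
  (h.differentiable (by simp) x).hasFDerivAt.congr_fderiv (eq_linForm _)

theorem pd_pd_comm {φ : (Fin 2 → ℝ) → ℝ} (h : ContDiff ℝ (⊤ : ℕ∞) φ) (i j : Fin 2) :
    pd i (pd j φ) = pd j (pd i φ) := by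
  have key : ∀ (i j : Fin 2) (x : Fin 2 → ℝ),
      pd i (pd j φ) x = fderiv ℝ (fderiv ℝ φ) x (Pi.single i 1) (Pi.single j 1) := by
    intro i j x
    have hd : DifferentiableAt ℝ (fderiv ℝ φ) x :=
      (h.fderiv_right (m := (⊤ : ℕ∞)) (by simp)).differentiable (by simp) x
    have := (hd.hasFDerivAt.clm_apply (hasFDerivAt_const (Pi.single j (1 : ℝ)) x)).fderiv
    unfold pd
    rw [this]
    simp
  ext x
  rw [key, key]
  refine (h.contDiffAt.isSymmSndFDerivAt ?_).eq _ _
  rw [minSmoothness_of_isRCLikeNormedField]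
  exact WithTop.coe_le_coe.2 le_top

theorem hasJet_of_contDiff {φ : (Fin 2 → ℝ) → ℝ} (h : ContDiff ℝ (⊤ : ℕ∞) φ) (x : Fin 2 → ℝ) :
    HasJet φ x (pd 0 φ x) (pd 1 φ x) (pd 0 (pd 0 φ) x) (pd 0 (pd 1 φ) x)
      (pd 1 (pd 1 φ) x) :=
  ⟨pd 0 φ, pd 1 φ, .of_forall fun y => hasFDerivAt_of_contDiff h y,
    by simpa only [pd_pd_comm h 1 0] using hasFDerivAt_of_contDiff (contDiff_pd h 0) x,
    hasFDerivAt_of_contDiff (contDiff_pd h 1) x, rfl, rfl⟩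

theorem quadForm_nonneg {r σ t : ℝ} (hr : 0 < r) (hD : 0 < r * t - σ ^ 2) (u v : ℝ) :
    0 ≤ t * u ^ 2 - 2 * σ * u * v + r * v ^ 2 := by
  refine nonneg_of_mul_nonneg_right (a := r) ?_ hr
  nlinarith [sq_nonneg (r * v - σ * u), mul_nonneg hD.le (sq_nonneg u)]

theorem quadForm_pos {r σ t : ℝ} (hr : 0 < r) (hD : 0 < r * t - σ ^ 2) {u v : ℝ}
    (huv : u ≠ 0 ∨ v ≠ 0) : 0 < t * u ^ 2 - 2 * σ * u * v + r * v ^ 2 := by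
  refine pos_of_mul_pos_right (a := r) ?_ hr.le
  by_cases hu : u = 0
  · have hv : v ≠ 0 := huv.resolve_left (not_not.2 hu)
    subst hu
    have : 0 < (r * v) ^ 2 := by positivity
    nlinarith
  · have : 0 < u ^ 2 := by positivity
    nlinarith [sq_nonneg (r * v - σ * u), mul_pos hD this]

/-- At a critical point of `v + (log s) / 3 - log (T - f)` the contracted Hessian of this
function is negative. Here `κ = 1 / (T - f)`. -/
theorem growth_operator_neg {r σ t X Y P Q a b c e v₁ v₂ v₁₁ v₁₂ v₂₂ s κ : ℝ} (hr : 0 < r)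
    (hD : 0 < r * t - σ ^ 2) (hs : s = X * P + Y * Q) (hs0 : 0 < s) (hκ : 0 < κ)
    (h₁ : t * a - 2 * σ * b + r * c = -4 * (r * t - σ ^ 2) * v₁)
    (h₂ : t * b - 2 * σ * c + r * e = -4 * (r * t - σ ^ 2) * v₂)
    (hv : t * v₁₁ - 2 * σ * v₁₂ + r * v₂₂ =
      -3 * (t * v₁ ^ 2 - 2 * σ * v₁ * v₂ + r * v₂ ^ 2))
    (hc₁ : v₁ + 1 / 3 * (s⁻¹ * (P + X * r + Y * σ)) + κ * P = 0)
    (hc₂ : v₂ + 1 / 3 * (s⁻¹ * (Q + X * σ + Y * t)) + κ * Q = 0) :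
    t * (v₁₁ + 1 / 3 * (-(s ^ 2)⁻¹ * (P + X * r + Y * σ) * (P + X * r + Y * σ) +
          s⁻¹ * (2 * r + X * a + Y * b)) + (κ ^ 2 * P * P + κ * r)) -
      2 * σ * (v₁₂ + 1 / 3 * (-(s ^ 2)⁻¹ * (P + X * r + Y * σ) * (Q + X * σ + Y * t) +
          s⁻¹ * (2 * σ + X * b + Y * c)) + (κ ^ 2 * P * Q + κ * σ)) +
      r * (v₂₂ + 1 / 3 * (-(s ^ 2)⁻¹ * (Q + X * σ + Y * t) * (Q + X * σ + Y * t) +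
          s⁻¹ * (2 * t + X * c + Y * e)) + (κ ^ 2 * Q * Q + κ * t)) < 0 := by
  have hPQ : P ≠ 0 ∨ Q ≠ 0 := by
    by_contra! h
    rw [h.1, h.2] at hs
    linarith
  rw [← inv_pow]
  obtain ⟨i, hi⟩ : ∃ i, i = s⁻¹ := ⟨_, rfl⟩
  have hi0 : 0 < i := hi ▸ inv_pos.2 hs0
  have his : i * (X * P + Y * Q) = 1 := by rw [hi, ← hs, inv_mul_cancel₀ hs0.ne']
  rw [← hi] at hc₁ hc₂ ⊢
  have hv₁ : v₁ = -(1 / 3 * (i * (P + X * r + Y * σ)) + κ * P) := by linarith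
  have hv₂ : v₂ = -(1 / 3 * (i * (Q + X * σ + Y * t)) + κ * Q) := by linarith
  have hN := quadForm_pos hr hD hPQ
  have hM := quadForm_nonneg hr hD ((i / 3 + κ) * P - i / 3 * (X * r + Y * σ))
    ((i / 3 + κ) * Q - i / 3 * (X * σ + Y * t))
  have hk : 0 < ((i / 3 + κ) ^ 2 + i ^ 2 / 3 - κ ^ 2) * (t * P ^ 2 - 2 * σ * P * Q + r * Q ^ 2) := by
    refine mul_pos ?_ hN
    have := mul_pos hi0 hκ
    nlinarith
  rw [hv₁, hv₂] at hv
  rw [hv₁] at h₁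
  rw [hv₂] at h₂
  refine lt_of_eq_of_lt (b := -(2 * (t * ((i / 3 + κ) * P - i / 3 * (X * r + Y * σ)) ^ 2 -
    2 * σ * ((i / 3 + κ) * P - i / 3 * (X * r + Y * σ)) *
      ((i / 3 + κ) * Q - i / 3 * (X * σ + Y * t)) +
    r * ((i / 3 + κ) * Q - i / 3 * (X * σ + Y * t)) ^ 2)) -
    ((i / 3 + κ) ^ 2 + i ^ 2 / 3 - κ ^ 2) * (t * P ^ 2 - 2 * σ * P * Q + r * Q ^ 2)) ?_
    (by linarith)
  linear_combination hv + 1 / 3 * i * X * h₁ + 1 / 3 * i * Y * h₂ -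
    (r * t - σ ^ 2) * (2 * (i / 3 + κ) + 2 / 3 * i) * his

theorem barrier_operator_neg {r σ t X Y P Q a b c e v₁ v₂ v₁₁ v₁₂ v₂₂ s ψ₁ ψ₂ : ℝ} (hr : 0 < r)
    (hD : 0 < r * t - σ ^ 2) (hs : s = X * P + Y * Q)
    (hψ : ψ₁ ^ 2 + ψ₂ ≤ 0) (hψ' : ψ₁ + s * ψ₂ < 0)
    (h₁ : t * a - 2 * σ * b + r * c = -4 * (r * t - σ ^ 2) * v₁)
    (h₂ : t * b - 2 * σ * c + r * e = -4 * (r * t - σ ^ 2) * v₂)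
    (hv : t * v₁₁ - 2 * σ * v₁₂ + r * v₂₂ =
      -3 * (t * v₁ ^ 2 - 2 * σ * v₁ * v₂ + r * v₂ ^ 2)) :
    t * (ψ₂ * (P + X * r + Y * σ) * (P + X * r + Y * σ) + ψ₁ * (2 * r + X * a + Y * b) + v₁₁) -
      2 * σ * (ψ₂ * (P + X * r + Y * σ) * (Q + X * σ + Y * t) + ψ₁ * (2 * σ + X * b + Y * c) +
        v₁₂) +
      r * (ψ₂ * (Q + X * σ + Y * t) * (Q + X * σ + Y * t) + ψ₁ * (2 * t + X * c + Y * e) + v₂₂) +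
      2 * (t * v₁ * (ψ₁ * (P + X * r + Y * σ) + v₁) -
        σ * (v₁ * (ψ₁ * (Q + X * σ + Y * t) + v₂) + v₂ * (ψ₁ * (P + X * r + Y * σ) + v₁)) +
        r * v₂ * (ψ₁ * (Q + X * σ + Y * t) + v₂)) < 0 := by
  have hM := quadForm_nonneg hr hD (v₁ - ψ₁ * (P - (X * r + Y * σ)))
    (v₂ - ψ₁ * (Q - (X * σ + Y * t)))
  have hN := mul_nonneg (neg_nonneg.2 hψ)
    (quadForm_nonneg hr hD (P - (X * r + Y * σ)) (Q - (X * σ + Y * t)))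
  have hS := mul_pos hD (neg_pos.2 hψ')
  rw [hs] at hS
  linear_combination hv + ψ₁ * X * h₁ + ψ₁ * Y * h₂ + hM + hN + 4 * hS
section NoLocalMin

variable {E : Type*} [MetricSpace E] {x₀ : E}

theorem le_of_forall_not_isLocalMin_sub_log {F Φ : E → ℝ} (hF : Continuous F)
    (hF0 : ∀ z, 0 ≤ F z) (hFc : ∀ T, IsCompact {z | F z ≤ T}) (hΦ : ContinuousOn Φ {x₀}ᶜ)
    (hno : ∀ T z, z ≠ x₀ → F z < T →
      ¬ IsLocalMin (fun y => Φ y + -1 * Real.log (T - F y)) z)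
    {r₀ m : ℝ} (hr₀ : 0 < r₀) (hm : ∀ z, dist z x₀ = r₀ → m ≤ Φ z) {y : E}
    (hy : r₀ ≤ dist y x₀) : m ≤ Φ y := by
  have hne : ∀ z, r₀ ≤ dist z x₀ → z ≠ x₀ := fun z hz h => by
    rw [h, dist_self] at hz
    linarith
  have key : ∀ T, F y < T → (T - F y) * Real.exp (-Φ y) ≤ T * Real.exp (-m) := by
    intro T hT
    set K : Set E := {z | F z ≤ T} ∩ {z | r₀ ≤ dist z x₀} with hK
    have hKc : IsCompact K :=
      (hFc T).inter_right (isClosed_le continuous_const (continuous_id.dist continuous_const))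
    have hKs : K ⊆ {x₀}ᶜ := fun z hz => hne z hz.2
    have hg : ContinuousOn (fun z => (T - F z) * Real.exp (-Φ z)) K :=
      (continuous_const.sub hF).continuousOn.mul (hΦ.mono hKs).neg.rexp
    obtain ⟨z, hzK, hz⟩ := hKc.exists_isMaxOn ⟨y, hT.le, hy⟩ hg
    have hzy : (T - F y) * Real.exp (-Φ y) ≤ (T - F z) * Real.exp (-Φ z) := hz ⟨hT.le, hy⟩
    have hFz : F z < T := by
      have h1 : 0 < (T - F y) * Real.exp (-Φ y) :=
        mul_pos (sub_pos.2 hT) (Real.exp_pos _)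
      exact sub_pos.1 (pos_of_mul_pos_left (h1.trans_le hzy) (Real.exp_pos _).le)
    rcases (show r₀ ≤ dist z x₀ from hzK.2).eq_or_lt with h | h
    · refine hzy.trans (mul_le_mul (by linarith [hF0 z]) ?_ (Real.exp_pos _).le
        (by linarith [hF0 z]))
      exact Real.exp_le_exp.2 (neg_le_neg (hm z h.symm))
    · refine absurd ?_ (hno T z (hne z hzK.2) hFz)
      filter_upwards [hF.continuousAt.eventually_lt continuousAt_const hFz,
        continuousAt_const.eventually_lt (continuous_id.dist continuous_const).continuousAt h]
        with u hu₁ hu₂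
      have h1 : (T - F u) * Real.exp (-Φ u) ≤ (T - F z) * Real.exp (-Φ z) :=
        hz ⟨hu₁.le, hu₂.le⟩
      have h2 := Real.log_le_log (mul_pos (sub_pos.2 hu₁) (Real.exp_pos _)) h1
      rw [Real.log_mul (sub_pos.2 hu₁).ne' (Real.exp_pos _).ne',
        Real.log_mul (sub_pos.2 hFz).ne' (Real.exp_pos _).ne', Real.log_exp, Real.log_exp] at h2
      linarith
  by_contra! hlt
  have hE : 0 < Real.exp (-Φ y) - Real.exp (-m) :=
    sub_pos.2 (Real.exp_lt_exp.2 (neg_lt_neg hlt))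
  have hq : 0 ≤ F y * Real.exp (-Φ y) / (Real.exp (-Φ y) - Real.exp (-m)) :=
    div_nonneg (mul_nonneg (hF0 y) (Real.exp_pos _).le) hE.le
  have h1 := key (F y * Real.exp (-Φ y) / (Real.exp (-Φ y) - Real.exp (-m)) + (F y + 1))
    (by linarith)
  have h2 := div_mul_cancel₀ (F y * Real.exp (-Φ y)) hE.ne'
  have h3 := mul_pos (show 0 < F y + 1 by linarith [hF0 y]) hE
  nlinarith

theorem le_of_forall_not_isLocalMin_add [ProperSpace E] {h Θ : E → ℝ} (hh : Continuous h) (hh0 : ∀ z, 0 ≤ h z)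
    (hΘ : ContinuousOn Θ {x₀}ᶜ) (hΘt : Tendsto Θ (cocompact E) atTop)
    (hno : ∀ ε > 0, ∀ z, z ≠ x₀ → ¬ IsLocalMin (fun y => h y + ε * Θ y) z) (y : E) :
    h x₀ ≤ h y := by
  by_contra! hlt
  obtain ⟨δ, hδ, hball⟩ := Metric.eventually_nhds_iff.1
    (continuousAt_const.eventually_lt hh.continuousAt
      (show (h x₀ + h y) / 2 < h x₀ by linarith))
  set r₀ := δ / 2 with hr₀
  have hr₀0 : 0 < r₀ := by positivity
  have hyr : r₀ < dist y x₀ := by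
    by_contra! hle
    have := hball (y := y) (by linarith)
    linarith
  obtain ⟨M, hM⟩ := ((isCompact_sphere x₀ r₀).image_of_continuousOn (hΘ.mono
    (fun z hz hz' => by
      rw [Metric.mem_sphere, Set.mem_singleton_iff.1 hz', dist_self] at hz
      linarith))).bddBelow
  have hMz : ∀ z, dist z x₀ = r₀ → M ≤ Θ z := fun z hz => hM (Set.mem_image_of_mem _ hz)
  obtain ⟨ε, hε, hεs⟩ : ∃ ε > 0, ε * (Θ y - M) < (h x₀ - h y) / 2 := by
    have h0 : 0 < |Θ y - M| + 1 := by positivity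
    refine ⟨(h x₀ - h y) / 2 / (|Θ y - M| + 1), div_pos (by linarith) h0, ?_⟩
    rw [div_mul_eq_mul_div, div_lt_iff₀ h0]
    exact mul_lt_mul_of_pos_left (by linarith [le_abs_self (Θ y - M)]) (by linarith)
  have hgt : ∀ᶠ z in cocompact E, h y + ε * Θ y < h z + ε * Θ z := by
    filter_upwards [hΘt.eventually_gt_atTop ((h y + ε * Θ y) / ε)] with z hz
    rw [div_lt_iff₀ hε] at hz
    linarith [hh0 z]
  obtain ⟨t, ht, htc⟩ := mem_cocompact.1 hgt
  have hout : ∀ z, z ∉ t → h y + ε * Θ y < h z + ε * Θ z := fun z hz => htc hz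
  have hKc : IsCompact (t ∩ {z | r₀ ≤ dist z x₀}) :=
    ht.inter_right (isClosed_le continuous_const (continuous_id.dist continuous_const))
  have hyt : y ∈ t := by
    by_contra hy
    exact lt_irrefl _ (hout y hy)
  have hne : ∀ z, r₀ ≤ dist z x₀ → z ≠ x₀ := fun z hz h => by
    rw [h, dist_self] at hz
    linarith
  have hcont : ContinuousOn (fun z => h z + ε * Θ z) (t ∩ {z | r₀ ≤ dist z x₀}) :=
    hh.continuousOn.add (continuousOn_const.mul (hΘ.mono fun z hz => hne z hz.2))
  obtain ⟨z, hzK, hz⟩ := hKc.exists_isMinOn ⟨y, hyt, hyr.le⟩ hcont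
  have hzy : h z + ε * Θ z ≤ h y + ε * Θ y := hz ⟨hyt, hyr.le⟩
  rcases (show r₀ ≤ dist z x₀ from hzK.2).eq_or_lt with h' | h'
  · have h1 := hball (y := z) (by linarith)
    have h2 := mul_le_mul_of_nonneg_left (hMz z h'.symm) hε.le
    linarith
  · refine hno ε hε z (hne z hzK.2) ?_
    filter_upwards [continuousAt_const.eventually_lt
      (continuous_id.dist continuous_const).continuousAt h'] with u hu
    by_cases hut : u ∈ t
    · exact hz ⟨hut, hu.le⟩
    · exact hzy.trans (hout u hut).le

end NoLocalMin

/-- The determinant of the Hessian of `f` on `ℝ²`, written out. -/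
noncomputable def detHess (f : (Fin 2 → ℝ) → ℝ) (y : Fin 2 → ℝ) : ℝ :=
  pd 0 (pd 0 f) y * pd 1 (pd 1 f) y - pd 0 (pd 1 f) y ^ 2

/-- The logarithm of `rho f` on `ℝ²`. -/
noncomputable def logRho (f : (Fin 2 → ℝ) → ℝ) (y : Fin 2 → ℝ) : ℝ :=
  -1 / 4 * Real.log (detHess f y)

/-- The difference between `f` and its affine Taylor polynomial at `x₀`. -/
noncomputable def bregman (f : (Fin 2 → ℝ) → ℝ) (x₀ y : Fin 2 → ℝ) : ℝ :=
  f y + ((-pd 0 f x₀) * y 0 + (-pd 1 f x₀) * y 1 +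
    (pd 0 f x₀ * x₀ 0 + pd 1 f x₀ * x₀ 1 - f x₀))

/-- The pairing `⟨y - x₀, ∇f(y) - ∇f(x₀)⟩`. -/
noncomputable def gradGap (f : (Fin 2 → ℝ) → ℝ) (x₀ y : Fin 2 → ℝ) : ℝ :=
  (y 0 - x₀ 0) * (pd 0 f y - pd 0 f x₀) + (y 1 - x₀ 1) * (pd 1 f y - pd 1 f x₀)

section StrictlyConvex

variable {f : (Fin 2 → ℝ) → ℝ}

theorem pd_pd_self_pos (hc : ∀ x, (hess f x).PosDef) (x : Fin 2 → ℝ) :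
    0 < pd 0 (pd 0 f) x := by
  simpa [hess] using (hc x).diag_pos (i := 0)

theorem det_hess_eq (hf : ContDiff ℝ (⊤ : ℕ∞) f) (x : Fin 2 → ℝ) :
    (hess f x).det = detHess f x := by
  rw [Matrix.det_fin_two, detHess]
  simp only [hess, Matrix.of_apply]
  rw [pd_pd_comm hf 1 0]
  ring

theorem detHess_pos (hf : ContDiff ℝ (⊤ : ℕ∞) f) (hc : ∀ x, (hess f x).PosDef)
    (x : Fin 2 → ℝ) : 0 < detHess f x :=
  det_hess_eq hf x ▸ (hc x).det_pos

theorem contDiff_detHess (hf : ContDiff ℝ (⊤ : ℕ∞) f) : ContDiff ℝ (⊤ : ℕ∞) (detHess f) := by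
  have h := fun i j => contDiff_pd (contDiff_pd hf i) j
  exact ((h 0 0).mul (h 1 1)).sub ((h 1 0).pow 2)

theorem contDiff_logRho (hf : ContDiff ℝ (⊤ : ℕ∞) f) (hc : ∀ x, (hess f x).PosDef) :
    ContDiff ℝ (⊤ : ℕ∞) (logRho f) :=
  contDiff_const.mul ((contDiff_detHess hf).log fun x => (detHess_pos hf hc x).ne')

theorem hasJet_bregman (hf : ContDiff ℝ (⊤ : ℕ∞) f) (x₀ y : Fin 2 → ℝ) :
    HasJet (bregman f x₀) y (pd 0 f y - pd 0 f x₀) (pd 1 f y - pd 1 f x₀)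
      (pd 0 (pd 0 f) y) (pd 0 (pd 1 f) y) (pd 1 (pd 1 f) y) :=
  ((hasJet_of_contDiff hf y).add (.affine _ _ _ y)).congr_jet
    (by ring) (by ring) (by ring) (by ring) (by ring)

theorem hasJet_gradGap (hf : ContDiff ℝ (⊤ : ℕ∞) f) (x₀ y : Fin 2 → ℝ) :
    HasJet (gradGap f x₀) y
      ((pd 0 f y - pd 0 f x₀) + (y 0 - x₀ 0) * pd 0 (pd 0 f) y + (y 1 - x₀ 1) * pd 0 (pd 1 f) y)
      ((pd 1 f y - pd 1 f x₀) + (y 0 - x₀ 0) * pd 0 (pd 1 f) y + (y 1 - x₀ 1) * pd 1 (pd 1 f) y)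
      (2 * pd 0 (pd 0 f) y + (y 0 - x₀ 0) * pd 0 (pd 0 (pd 0 f)) y +
        (y 1 - x₀ 1) * pd 0 (pd 0 (pd 1 f)) y)
      (2 * pd 0 (pd 1 f) y + (y 0 - x₀ 0) * pd 0 (pd 0 (pd 1 f)) y +
        (y 1 - x₀ 1) * pd 0 (pd 1 (pd 1 f)) y)
      (2 * pd 1 (pd 1 f) y + (y 0 - x₀ 0) * pd 0 (pd 1 (pd 1 f)) y +
        (y 1 - x₀ 1) * pd 1 (pd 1 (pd 1 f)) y) := by
  have c₀ := (hasJet_of_contDiff (contDiff_pd hf 0) y).add (.const (-pd 0 f x₀) y)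
  have c₁ := (hasJet_of_contDiff (contDiff_pd hf 1) y).add (.const (-pd 1 f x₀) y)
  have k := ((HasJet.affine 1 0 (-x₀ 0) y).mul c₀).add ((HasJet.affine 0 1 (-x₀ 1) y).mul c₁)
  have e : gradGap f x₀ = fun y => (1 * y 0 + 0 * y 1 + -x₀ 0) * (pd 0 f y + -pd 0 f x₀) +
      (0 * y 0 + 1 * y 1 + -x₀ 1) * (pd 1 f y + -pd 1 f x₀) := by
    funext y
    rw [gradGap]
    ring
  rw [e]
  have e₁ := pd_pd_comm hf 1 0
  have e₂ := pd_pd_comm (contDiff_pd hf 1) 1 0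
  rw [e₁, e₂] at k
  refine k.congr_jet ?_ ?_ ?_ ?_ ?_ <;> ring

theorem hasJet_detHess (hf : ContDiff ℝ (⊤ : ℕ∞) f) (y : Fin 2 → ℝ) :
    HasJet (detHess f) y
      (pd 1 (pd 1 f) y * pd 0 (pd 0 (pd 0 f)) y - 2 * pd 0 (pd 1 f) y * pd 0 (pd 0 (pd 1 f)) y +
        pd 0 (pd 0 f) y * pd 0 (pd 1 (pd 1 f)) y)
      (pd 1 (pd 1 f) y * pd 1 (pd 0 (pd 0 f)) y - 2 * pd 0 (pd 1 f) y * pd 1 (pd 0 (pd 1 f)) y +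
        pd 0 (pd 0 f) y * pd 1 (pd 1 (pd 1 f)) y)
      (pd 1 (pd 1 f) y * pd 0 (pd 0 (pd 0 (pd 0 f))) y +
        pd 0 (pd 0 (pd 0 f)) y * pd 0 (pd 1 (pd 1 f)) y + pd 0 (pd 0 (pd 0 f)) y * pd 0 (pd 1 (pd 1 f)) y -
        2 * (pd 0 (pd 1 f) y * pd 0 (pd 0 (pd 0 (pd 1 f))) y +
          pd 0 (pd 0 (pd 1 f)) y * pd 0 (pd 0 (pd 1 f)) y) +
        pd 0 (pd 0 f) y * pd 0 (pd 0 (pd 1 (pd 1 f))) y)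
      (pd 1 (pd 1 f) y * pd 0 (pd 1 (pd 0 (pd 0 f))) y +
        pd 0 (pd 0 (pd 0 f)) y * pd 1 (pd 1 (pd 1 f)) y + pd 1 (pd 0 (pd 0 f)) y * pd 0 (pd 1 (pd 1 f)) y -
        2 * (pd 0 (pd 1 f) y * pd 0 (pd 1 (pd 0 (pd 1 f))) y +
          pd 0 (pd 0 (pd 1 f)) y * pd 1 (pd 0 (pd 1 f)) y) +
        pd 0 (pd 0 f) y * pd 0 (pd 1 (pd 1 (pd 1 f))) y)
      (pd 1 (pd 1 f) y * pd 1 (pd 1 (pd 0 (pd 0 f))) y +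
        pd 1 (pd 0 (pd 0 f)) y * pd 1 (pd 1 (pd 1 f)) y + pd 1 (pd 0 (pd 0 f)) y * pd 1 (pd 1 (pd 1 f)) y -
        2 * (pd 0 (pd 1 f) y * pd 1 (pd 1 (pd 0 (pd 1 f))) y +
          pd 1 (pd 0 (pd 1 f)) y * pd 1 (pd 0 (pd 1 f)) y) +
        pd 0 (pd 0 f) y * pd 1 (pd 1 (pd 1 (pd 1 f))) y) := by
  have h := fun i j => hasJet_of_contDiff (contDiff_pd (contDiff_pd hf i) j) y
  have hD := ((h 0 0).mul (h 1 1)).add (((h 1 0).mul (h 1 0)).const_mul (-1))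
  have e : detHess f = fun y => pd 0 (pd 0 f) y * pd 1 (pd 1 f) y +
      -1 * (pd 0 (pd 1 f) y * pd 0 (pd 1 f) y) := by
    funext y
    rw [detHess]
    ring
  rw [e]
  refine hD.congr_jet ?_ ?_ ?_ ?_ ?_ <;> ring

/-- The first derivatives of `log (det D²f)`. -/
theorem pd_logRho (hf : ContDiff ℝ (⊤ : ℕ∞) f) (hc : ∀ x, (hess f x).PosDef)
    (y : Fin 2 → ℝ) (i : Fin 2) :
    pd 1 (pd 1 f) y * pd i (pd 0 (pd 0 f)) y - 2 * pd 0 (pd 1 f) y * pd i (pd 0 (pd 1 f)) y +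
      pd 0 (pd 0 f) y * pd i (pd 1 (pd 1 f)) y = -4 * detHess f y * pd i (logRho f) y := by
  have hD := hasJet_detHess hf y
  have hD0 := (detHess_pos hf hc y).ne'
  obtain ⟨k₀, k₁⟩ := ((hD.log (detHess_pos hf hc y)).const_mul (-1 / 4)).pd_eq
  have e' : (fun y => -1 / 4 * Real.log (detHess f y)) = logRho f := rfl
  rw [e'] at k₀ k₁
  fin_cases i
  · simp only [Fin.zero_eta]
    rw [k₀]
    field_simp
  · simp only [Fin.mk_one]
    rw [k₁]
    field_simp

/-- The affine maximal surface equation in terms of `log ρ`. -/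
theorem logRho_equation (hf : ContDiff ℝ (⊤ : ℕ∞) f) (hc : ∀ x, (hess f x).PosDef)
    (hpde : PDE1 f (-3 / 4) Set.univ) (y : Fin 2 → ℝ) :
    pd 1 (pd 1 f) y * pd 0 (pd 0 (logRho f)) y -
        2 * pd 0 (pd 1 f) y * pd 0 (pd 1 (logRho f)) y +
        pd 0 (pd 0 f) y * pd 1 (pd 1 (logRho f)) y =
      -3 * (pd 1 (pd 1 f) y * pd 0 (logRho f) y ^ 2 -
        2 * pd 0 (pd 1 f) y * pd 0 (logRho f) y * pd 1 (logRho f) y +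
        pd 0 (pd 0 f) y * pd 1 (logRho f) y ^ 2) := by
  have hw : (fun y => (hess f y).det ^ (-3 / 4 : ℝ)) = fun y => Real.exp (3 * logRho f y) := by
    funext y
    rw [det_hess_eq hf, Real.rpow_def_of_pos (detHess_pos hf hc y), logRho]
    congr 1
    ring
  have hj := ((hasJet_of_contDiff (contDiff_logRho hf hc) y).const_mul 3).comp
    (.of_forall Real.hasDerivAt_exp) (Real.hasDerivAt_exp _)
  obtain ⟨k₀₀, k₀₁, k₁₀, k₁₁⟩ := hj.pd_pd_eq
  have h := hpde y (Set.mem_univ y)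
  rw [hw] at h
  simp only [Fin.sum_univ_two, k₀₀, k₀₁, k₁₀, k₁₁, cof, Matrix.adjugate_fin_two,
    Matrix.transpose_apply, hess, Matrix.of_apply, Matrix.cons_val', Matrix.cons_val_zero,
    Matrix.cons_val_one, Matrix.cons_val_fin_one, pd_pd_comm hf 1 0] at h
  have hE := Real.exp_pos (3 * logRho f y)
  have h' : 3 * Real.exp (3 * logRho f y) * (pd 1 (pd 1 f) y * pd 0 (pd 0 (logRho f)) y -
        2 * pd 0 (pd 1 f) y * pd 0 (pd 1 (logRho f)) y +
        pd 0 (pd 0 f) y * pd 1 (pd 1 (logRho f)) y +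
      3 * (pd 1 (pd 1 f) y * pd 0 (logRho f) y ^ 2 -
        2 * pd 0 (pd 1 f) y * pd 0 (logRho f) y * pd 1 (logRho f) y +
        pd 0 (pd 0 f) y * pd 1 (logRho f) y ^ 2)) = 0 := by
    rw [← h]
    ring
  have := (mul_eq_zero.1 h').resolve_left (by positivity)
  linarith

/-- Restriction of the gradient of `f` to a line. -/
theorem hasDerivAt_gradient_line (hf : ContDiff ℝ (⊤ : ℕ∞) f) (x₀ d : Fin 2 → ℝ) (τ : ℝ) :
    HasDerivAt (fun τ : ℝ => d 0 * (pd 0 f (x₀ + τ • d) - pd 0 f x₀) +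
        d 1 * (pd 1 f (x₀ + τ • d) - pd 1 f x₀))
      (pd 0 (pd 0 f) (x₀ + τ • d) * d 0 ^ 2 + 2 * pd 0 (pd 1 f) (x₀ + τ • d) * d 0 * d 1 +
        pd 1 (pd 1 f) (x₀ + τ • d) * d 1 ^ 2) τ := by
  have hγ : HasDerivAt (fun τ : ℝ => x₀ + τ • d) d τ := by
    simpa using ((hasDerivAt_id τ).smul_const d).const_add x₀
  have h := fun i => (hasFDerivAt_of_contDiff (contDiff_pd hf i) (x₀ + τ • d)).comp_hasDerivAt τ hγ
  refine ((((h 0).sub_const _).const_mul (d 0)).add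
    (((h 1).sub_const _).const_mul (d 1))).congr_deriv ?_
  rw [pd_pd_comm hf 1 0]
  simp
  ring

theorem hasDerivAt_bregman_line (hf : ContDiff ℝ (⊤ : ℕ∞) f) (x₀ d : Fin 2 → ℝ) (τ : ℝ) :
    HasDerivAt (fun τ : ℝ => bregman f x₀ (x₀ + τ • d))
      (d 0 * (pd 0 f (x₀ + τ • d) - pd 0 f x₀) + d 1 * (pd 1 f (x₀ + τ • d) - pd 1 f x₀)) τ := by
  have hγ : HasDerivAt (fun τ : ℝ => x₀ + τ • d) d τ := by
    simpa using ((hasDerivAt_id τ).smul_const d).const_add x₀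
  obtain ⟨G₀, G₁, h, -, -, e₀, e₁⟩ := hasJet_bregman hf x₀ (x₀ + τ • d)
  refine (h.self_of_nhds.comp_hasDerivAt τ hγ).congr_deriv ?_
  rw [e₀, e₁, linForm_apply]
  ring

theorem strictMono_gradient_line (hf : ContDiff ℝ (⊤ : ℕ∞) f) (hc : ∀ x, (hess f x).PosDef)
    (x₀ : Fin 2 → ℝ) {d : Fin 2 → ℝ} (hd : d ≠ 0) :
    StrictMono fun τ : ℝ => d 0 * (pd 0 f (x₀ + τ • d) - pd 0 f x₀) +
      d 1 * (pd 1 f (x₀ + τ • d) - pd 1 f x₀) := by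
  refine strictMono_of_deriv_pos fun τ => ?_
  rw [(hasDerivAt_gradient_line hf x₀ d τ).deriv]
  have hd' : d 1 ≠ 0 ∨ -d 0 ≠ 0 := by
    by_contra! h
    refine hd ?_
    ext i
    fin_cases i
    · simpa using h.2
    · simpa using h.1
  have := quadForm_pos (pd_pd_self_pos hc (x₀ + τ • d)) (detHess_pos hf hc (x₀ + τ • d)) hd'
  linarith

theorem bregman_self (x₀ : Fin 2 → ℝ) : bregman f x₀ x₀ = 0 := by
  rw [bregman]
  ring

theorem bregman_pos_and_lt_gradGap (hf : ContDiff ℝ (⊤ : ℕ∞) f) (hc : ∀ x, (hess f x).PosDef)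
    {x₀ y : Fin 2 → ℝ} (hy : y ≠ x₀) :
    0 < bregman f x₀ y ∧ bregman f x₀ y < gradGap f x₀ y := by
  have hm := strictMono_gradient_line hf hc x₀ (sub_ne_zero.2 hy)
  obtain ⟨ξ, hξ, he⟩ := exists_hasDerivAt_eq_slope _ _ zero_lt_one
    (fun τ _ => (hasDerivAt_bregman_line hf x₀ (y - x₀) τ).continuousAt.continuousWithinAt)
    fun τ _ => hasDerivAt_bregman_line hf x₀ (y - x₀) τ
  have h0 := hm hξ.1
  have h1 := hm hξ.2
  simp only at h0 h1
  rw [he] at h0 h1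
  simp only [zero_smul, one_smul, add_zero, add_sub_cancel, sub_self, mul_zero, sub_zero,
    div_one, bregman_self, Pi.sub_apply] at h0 h1
  exact ⟨h0, h1⟩

theorem bregman_nonneg (hf : ContDiff ℝ (⊤ : ℕ∞) f) (hc : ∀ x, (hess f x).PosDef)
    (x₀ y : Fin 2 → ℝ) : 0 ≤ bregman f x₀ y := by
  rcases eq_or_ne y x₀ with rfl | hy
  · exact (bregman_self y).ge
  · exact (bregman_pos_and_lt_gradGap hf hc hy).1.le

theorem mul_bregman_le (hf : ContDiff ℝ (⊤ : ℕ∞) f) (hc : ∀ x, (hess f x).PosDef)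
    (x₀ : Fin 2 → ℝ) {d : Fin 2 → ℝ} (hd : d ≠ 0) {τ : ℝ} (hτ : 1 ≤ τ) :
    τ * bregman f x₀ (x₀ + d) ≤ bregman f x₀ (x₀ + τ • d) := by
  rcases hτ.eq_or_lt with rfl | hτ
  · simp
  have hm := strictMono_gradient_line hf hc x₀ hd
  obtain ⟨ξ, hξ, he⟩ := exists_hasDerivAt_eq_slope _ _ hτ
    (fun τ _ => (hasDerivAt_bregman_line hf x₀ d τ).continuousAt.continuousWithinAt)
    fun τ _ => hasDerivAt_bregman_line hf x₀ d τ
  have h1 := hm hξ.1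
  simp only at h1
  rw [he, lt_div_iff₀ (sub_pos.2 hτ)] at h1
  have h2 := (bregman_pos_and_lt_gradGap hf hc (x₀ := x₀) (y := x₀ + d) (by simpa using hd)).2
  simp only [gradGap, Pi.add_apply, add_sub_cancel_left] at h2
  simp only [one_smul] at h1
  have h3 := mul_lt_mul_of_pos_right h2 (sub_pos.2 hτ)
  linarith

/-- A strictly convex function grows at least linearly above its tangent plane. -/
theorem tendsto_bregman (hf : ContDiff ℝ (⊤ : ℕ∞) f) (hc : ∀ x, (hess f x).PosDef)
    (x₀ : Fin 2 → ℝ) : Tendsto (bregman f x₀) (cocompact (Fin 2 → ℝ)) atTop := by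
  have hcont : Continuous (bregman f x₀) :=
    continuous_iff_continuousAt.2 fun y => (hasJet_bregman hf x₀ y).continuousAt
  obtain ⟨z, hz, hmin⟩ := (isCompact_sphere x₀ 1).exists_isMinOn
    (NormedSpace.sphere_nonempty.2 zero_le_one) hcont.continuousOn
  have hz0 : z ≠ x₀ := fun h => by simp [h] at hz
  have hpos := (bregman_pos_and_lt_gradGap hf hc hz0).1
  have hlin : Tendsto (fun y => bregman f x₀ z * dist y x₀) (cocompact (Fin 2 → ℝ)) atTop :=
    (tendsto_dist_right_cocompact_atTop x₀).const_mul_atTop hpos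
  refine tendsto_atTop_mono' _ ?_ hlin
  filter_upwards [(tendsto_dist_right_cocompact_atTop x₀).eventually_ge_atTop 1] with y hy
  have hn : 1 ≤ ‖y - x₀‖ := by rwa [← dist_eq_norm]
  have hn0 : ‖y - x₀‖ ≠ 0 := by positivity
  have hd : ‖‖y - x₀‖⁻¹ • (y - x₀)‖ = 1 := by
    rw [norm_smul, norm_inv, norm_norm, inv_mul_cancel₀ hn0]
  have h1 := mul_bregman_le hf hc x₀ (d := ‖y - x₀‖⁻¹ • (y - x₀))
    (fun h => by simp [h] at hd) hn
  rw [smul_smul, mul_inv_cancel₀ hn0, one_smul, add_sub_cancel] at h1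
  have h2 : bregman f x₀ z ≤ bregman f x₀ (x₀ + ‖y - x₀‖⁻¹ • (y - x₀)) :=
    hmin (by simpa [Metric.mem_sphere, dist_eq_norm] using hd)
  rw [dist_eq_norm]
  nlinarith

end StrictlyConvex

section AffineMaximal

variable {f : (Fin 2 → ℝ) → ℝ}

theorem pd_one_logRho (hf : ContDiff ℝ (⊤ : ℕ∞) f) (hc : ∀ x, (hess f x).PosDef)
    (y : Fin 2 → ℝ) :
    pd 1 (pd 1 f) y * pd 0 (pd 0 (pd 1 f)) y - 2 * pd 0 (pd 1 f) y * pd 0 (pd 1 (pd 1 f)) y +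
      pd 0 (pd 0 f) y * pd 1 (pd 1 (pd 1 f)) y = -4 * detHess f y * pd 1 (logRho f) y := by
  have h := pd_logRho hf hc y 1
  rwa [pd_pd_comm (contDiff_pd hf 0) 1 0, pd_pd_comm hf 1 0,
    pd_pd_comm (contDiff_pd hf 1) 1 0] at h

theorem growth_of_affineMaximal (hf : ContDiff ℝ (⊤ : ℕ∞) f) (hc : ∀ x, (hess f x).PosDef)
    (hpde : PDE1 f (-3 / 4) Set.univ) (x₀ : Fin 2 → ℝ) :
    ∃ m, ∀ y, 1 ≤ dist y x₀ → m ≤ logRho f y + 1 / 3 * Real.log (gradGap f x₀ y) := by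
  have hv := contDiff_logRho hf hc
  have hs : ∀ {z}, z ≠ x₀ → 0 < gradGap f x₀ z := fun hz =>
    (bregman_pos_and_lt_gradGap hf hc hz).1.trans (bregman_pos_and_lt_gradGap hf hc hz).2
  have hFcont : Continuous (bregman f x₀) :=
    continuous_iff_continuousAt.2 fun y => (hasJet_bregman hf x₀ y).continuousAt
  have hΦ : ContinuousOn (fun y => logRho f y + 1 / 3 * Real.log (gradGap f x₀ y)) {x₀}ᶜ :=
    fun z hz => (((hasJet_of_contDiff hv z).add
      (((hasJet_gradGap hf x₀ z).log (hs hz)).const_mul (1 / 3))).continuousAt).continuousWithinAt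
  obtain ⟨m, hm⟩ := ((isCompact_sphere x₀ 1).image_of_continuousOn (hΦ.mono
    (fun z hz hz' => by simp [Set.mem_singleton_iff.1 hz'] at hz))).bddBelow
  refine ⟨m, fun y hy => le_of_forall_not_isLocalMin_sub_log
    (Φ := fun y => logRho f y + 1 / 3 * Real.log (gradGap f x₀ y)) hFcont
    (bregman_nonneg hf hc x₀) (fun T => ?_) hΦ (fun T z hz hT hmin => ?_) zero_lt_one
    (fun z hz => hm (Set.mem_image_of_mem _ hz)) hy⟩
  · obtain ⟨t, ht, htc⟩ := mem_cocompact.1 ((tendsto_bregman hf hc x₀).eventually_gt_atTop T)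
    refine ht.of_isClosed_subset (isClosed_le hFcont continuous_const) fun z hz => ?_
    by_contra hzt
    exact absurd (show T < bregman f x₀ z from htc hzt) (not_lt.2 hz)
  · have hTF : HasJet (fun y => T - bregman f x₀ y) z (-(pd 0 f z - pd 0 f x₀))
        (-(pd 1 f z - pd 1 f x₀)) (-pd 0 (pd 0 f) z) (-pd 0 (pd 1 f) z)
        (-pd 1 (pd 1 f) z) := by
      have e : (fun y => T - bregman f x₀ y) = fun y => T + -1 * bregman f x₀ y := by
        funext y
        ring
      rw [e]
      exact ((HasJet.const T z).add ((hasJet_bregman hf x₀ z).const_mul (-1))).congr_jet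
        (by ring) (by ring) (by ring) (by ring) (by ring)
    have hj := ((hasJet_of_contDiff hv z).add
      (((hasJet_gradGap hf x₀ z).log (hs hz)).const_mul (1 / 3))).add
      ((hTF.log (sub_pos.2 hT)).const_mul (-1))
    obtain ⟨g₀, g₁, -⟩ := hj.of_isLocalMin hmin
    have hn := hj.contract_nonneg_of_isLocalMin hmin (pd_pd_self_pos hc z) (detHess_pos hf hc z)
    have hneg := growth_operator_neg (κ := (T - bregman f x₀ z)⁻¹) (pd_pd_self_pos hc z)
      (detHess_pos hf hc z) (rfl : gradGap f x₀ z = _) (hs hz) (inv_pos.2 (sub_pos.2 hT))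
      (pd_logRho hf hc z 0) (pd_one_logRho hf hc z) (logRho_equation hf hc hpde z)
      (by linarith) (by linarith)
    simp only [← inv_pow] at hn hneg
    linarith

/-- A Liouville property: nonnegative supersolutions of the weighted Laplace operator of an
affine maximal surface are constant. -/
theorem le_of_supersolution (hf : ContDiff ℝ (⊤ : ℕ∞) f) (hc : ∀ x, (hess f x).PosDef)
    (hpde : PDE1 f (-3 / 4) Set.univ) {h : (Fin 2 → ℝ) → ℝ} (hh : ContDiff ℝ (⊤ : ℕ∞) h)
    (hh0 : ∀ z, 0 ≤ h z)
    (hsuper : ∀ z, pd 1 (pd 1 f) z * pd 0 (pd 0 h) z - 2 * pd 0 (pd 1 f) z * pd 0 (pd 1 h) z +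
      pd 0 (pd 0 f) z * pd 1 (pd 1 h) z + 2 * (pd 1 (pd 1 f) z * pd 0 (logRho f) z * pd 0 h z -
        pd 0 (pd 1 f) z * (pd 0 (logRho f) z * pd 1 h z + pd 1 (logRho f) z * pd 0 h z) +
        pd 0 (pd 0 f) z * pd 1 (logRho f) z * pd 1 h z) ≤ 0) (x₀ y : Fin 2 → ℝ) :
    h x₀ ≤ h y := by
  have hv := contDiff_logRho hf hc
  have hs : ∀ {z}, z ≠ x₀ → 0 < gradGap f x₀ z := fun hz =>
    (bregman_pos_and_lt_gradGap hf hc hz).1.trans (bregman_pos_and_lt_gradGap hf hc hz).2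
  have hΘ : ∀ z (hz : z ≠ x₀), _ := fun z hz =>
    (HasJet.comp (ψ := fun τ => Real.log τ - 1 / 2 * Real.log (1 + τ))
      (ψ' := fun τ => τ⁻¹ - 1 / 2 * (1 + τ)⁻¹)
      (ψ'' := -(gradGap f x₀ z ^ 2)⁻¹ - 1 / 2 * -((1 + gradGap f x₀ z) ^ 2)⁻¹)
      ((eventually_gt_nhds (hs hz)).mono fun τ hτ =>
        (Real.hasDerivAt_log hτ.ne').sub (((Real.hasDerivAt_log
          (show 1 + τ ≠ 0 by positivity)).comp_const_add 1 τ).const_mul (1 / 2)))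
      ((hasDerivAt_inv (hs hz).ne').sub (((hasDerivAt_inv
          (show 1 + gradGap f x₀ z ≠ 0 from (add_pos one_pos (hs hz)).ne')).comp_const_add 1
            (gradGap f x₀ z)).const_mul (1 / 2)))
      (hasJet_gradGap hf x₀ z)).add (hasJet_of_contDiff hv z)
  obtain ⟨m, hm⟩ := growth_of_affineMaximal hf hc hpde x₀
  refine le_of_forall_not_isLocalMin_add hh.continuous hh0
    (Θ := fun y => (Real.log (gradGap f x₀ y) - 1 / 2 * Real.log (1 + gradGap f x₀ y)) +
      logRho f y) (fun z hz => (hΘ z hz).continuousAt.continuousWithinAt) ?_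
    (fun ε hε z hz hmin => ?_) y
  · have hst : Tendsto (gradGap f x₀) (cocompact (Fin 2 → ℝ)) atTop := by
      refine tendsto_atTop_mono' _ ?_ (tendsto_bregman hf hc x₀)
      filter_upwards [(tendsto_dist_right_cocompact_atTop x₀).eventually_ge_atTop 1] with z hz
      exact (bregman_pos_and_lt_gradGap hf hc
        (dist_pos.1 (zero_lt_one.trans_le hz))).2.le
    have hlim := tendsto_atTop_add_const_right _ (m - 1 / 2 * Real.log 2)
      ((Real.tendsto_log_atTop.comp hst).const_mul_atTop (show (0 : ℝ) < 1 / 6 by norm_num))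
    refine tendsto_atTop_mono' _ ?_ hlim
    filter_upwards [(tendsto_dist_right_cocompact_atTop x₀).eventually_ge_atTop 1,
      hst.eventually_ge_atTop 1] with z hz hz1
    have h1 := hm z hz
    have h2 : Real.log (1 + gradGap f x₀ z) ≤ Real.log 2 + Real.log (gradGap f x₀ z) := by
      rw [← Real.log_mul two_ne_zero (by positivity)]
      exact Real.log_le_log (by positivity) (by linarith)
    simp only [Function.comp_apply]
    linarith
  · have hj := (hasJet_of_contDiff hh z).add ((hΘ z hz).const_mul ε)
    obtain ⟨g₀, g₁, -⟩ := hj.of_isLocalMin hmin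
    have hn := hj.contract_nonneg_of_isLocalMin hmin (pd_pd_self_pos hc z) (detHess_pos hf hc z)
    have hsz := hs hz
    have hψ : ((gradGap f x₀ z)⁻¹ - 1 / 2 * (1 + gradGap f x₀ z)⁻¹) ^ 2 +
        (-(gradGap f x₀ z ^ 2)⁻¹ - 1 / 2 * -((1 + gradGap f x₀ z) ^ 2)⁻¹) ≤ 0 := by
      generalize gradGap f x₀ z = s at hsz
      have e : (s⁻¹ - 1 / 2 * (1 + s)⁻¹) ^ 2 + (-(s ^ 2)⁻¹ - 1 / 2 * -((1 + s) ^ 2)⁻¹) =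
          -((4 + s) / (4 * s * (1 + s) ^ 2)) := by
        field_simp
        ring
      rw [e]
      exact neg_nonpos.2 (by positivity)
    have hψ' : ((gradGap f x₀ z)⁻¹ - 1 / 2 * (1 + gradGap f x₀ z)⁻¹) +
        gradGap f x₀ z * (-(gradGap f x₀ z ^ 2)⁻¹ - 1 / 2 * -((1 + gradGap f x₀ z) ^ 2)⁻¹)
          < 0 := by
      generalize gradGap f x₀ z = s at hsz
      have e : (s⁻¹ - 1 / 2 * (1 + s)⁻¹) + s * (-(s ^ 2)⁻¹ - 1 / 2 * -((1 + s) ^ 2)⁻¹) =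
          -(1 / (2 * (1 + s) ^ 2)) := by
        field_simp
        ring
      rw [e]
      exact neg_neg_of_pos (by positivity)
    have hneg := mul_neg_of_pos_of_neg hε (barrier_operator_neg (pd_pd_self_pos hc z)
      (detHess_pos hf hc z) (rfl : gradGap f x₀ z = _) hψ hψ'
      (pd_logRho hf hc z 0) (pd_one_logRho hf hc z) (logRho_equation hf hc hpde z))
    have hsup := hsuper z
    generalize (gradGap f x₀ z)⁻¹ - 1 / 2 * (1 + gradGap f x₀ z)⁻¹ = ψ₁ at g₀ g₁ hn hneg
    generalize -(gradGap f x₀ z ^ 2)⁻¹ - 1 / 2 * -((1 + gradGap f x₀ z) ^ 2)⁻¹ = ψ₂ at hn hneg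
    refine lt_irrefl (0 : ℝ) ?_
    linear_combination hn + hneg + hsup - 2 * (pd 1 (pd 1 f) z * pd 0 (logRho f) z -
      pd 0 (pd 1 f) z * pd 1 (logRho f) z) * g₀ - 2 * (pd 0 (pd 0 f) z * pd 1 (logRho f) z -
      pd 0 (pd 1 f) z * pd 0 (logRho f) z) * g₁

theorem eq_of_supersolution (hf : ContDiff ℝ (⊤ : ℕ∞) f) (hc : ∀ x, (hess f x).PosDef)
    (hpde : PDE1 f (-3 / 4) Set.univ) {h : (Fin 2 → ℝ) → ℝ} (hh : ContDiff ℝ (⊤ : ℕ∞) h)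
    (hh0 : ∀ z, 0 ≤ h z)
    (hsuper : ∀ z, pd 1 (pd 1 f) z * pd 0 (pd 0 h) z - 2 * pd 0 (pd 1 f) z * pd 0 (pd 1 h) z +
      pd 0 (pd 0 f) z * pd 1 (pd 1 h) z + 2 * (pd 1 (pd 1 f) z * pd 0 (logRho f) z * pd 0 h z -
        pd 0 (pd 1 f) z * (pd 0 (logRho f) z * pd 1 h z + pd 1 (logRho f) z * pd 0 h z) +
        pd 0 (pd 0 f) z * pd 1 (logRho f) z * pd 1 h z) ≤ 0) (y : Fin 2 → ℝ) :
    h y = h 0 :=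
  le_antisymm (le_of_supersolution hf hc hpde hh hh0 hsuper y 0)
    (le_of_supersolution hf hc hpde hh hh0 hsuper 0 y)

theorem logRho_eq_of_affineMaximal (hf : ContDiff ℝ (⊤ : ℕ∞) f)
    (hc : ∀ x, (hess f x).PosDef) (hpde : PDE1 f (-3 / 4) Set.univ) (y : Fin 2 → ℝ) :
    logRho f y = logRho f 0 := by
  have hv := contDiff_logRho hf hc
  refine Real.exp_injective (eq_of_supersolution hf hc hpde (h := fun y => Real.exp (logRho f y))
    hv.exp (fun z => (Real.exp_pos _).le) (fun z => le_of_eq ?_) y)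
  have hj := (hasJet_of_contDiff hv z).comp (.of_forall Real.hasDerivAt_exp)
    (Real.hasDerivAt_exp _)
  obtain ⟨k₀₀, k₀₁, -, k₁₁⟩ := hj.pd_pd_eq
  rw [k₀₀, k₀₁, k₁₁, hj.pd_eq.1, hj.pd_eq.2]
  linear_combination Real.exp (logRho f z) * logRho_equation hf hc hpde z

theorem detHess_eq_of_affineMaximal (hf : ContDiff ℝ (⊤ : ℕ∞) f)
    (hc : ∀ x, (hess f x).PosDef) (hpde : PDE1 f (-3 / 4) Set.univ) (y : Fin 2 → ℝ) :
    detHess f y = detHess f 0 := by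
  have h := logRho_eq_of_affineMaximal hf hc hpde y
  simp only [logRho] at h
  exact Real.log_injOn_pos (detHess_pos hf hc y) (detHess_pos hf hc 0) (by linarith)

theorem pd_eq_zero_of_const {φ : (Fin 2 → ℝ) → ℝ} {c : ℝ} (h : ∀ y, φ y = c) (i : Fin 2)
    (z : Fin 2 → ℝ) : pd i φ z = 0 := by
  have e : φ = fun _ => c := funext h
  simp [pd, e]

/-- If `det D²f` is constant then `1 / f₁₁` is constant. -/
theorem pd_pd_self_eq_of_affineMaximal (hf : ContDiff ℝ (⊤ : ℕ∞) f)
    (hc : ∀ x, (hess f x).PosDef) (hpde : PDE1 f (-3 / 4) Set.univ) (y : Fin 2 → ℝ) :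
    pd 0 (pd 0 f) y = pd 0 (pd 0 f) 0 := by
  have hr := contDiff_pd (contDiff_pd hf 0) 0
  have hv := fun i => pd_eq_zero_of_const (logRho_eq_of_affineMaximal hf hc hpde) i
  have hpos := pd_pd_self_pos hc
  refine inv_injective (eq_of_supersolution hf hc hpde (h := fun y => (pd 0 (pd 0 f) y)⁻¹)
    (hr.inv fun z => (hpos z).ne') (fun z => (inv_pos.2 (hpos z)).le) (fun z => le_of_eq ?_) y)
  have hj := (hasJet_of_contDiff hr z).comp (ψ' := fun τ => -(τ ^ 2)⁻¹)
    (ψ'' := 2 * (pd 0 (pd 0 f) z)⁻¹ ^ 3)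
    ((eventually_gt_nhds (hpos z)).mono fun τ hτ => hasDerivAt_inv hτ.ne')
    ((((hasDerivAt_id (pd 0 (pd 0 f) z)).pow 2).inv (pow_ne_zero 2 (hpos z).ne')).neg.congr_deriv (by
      have := (hpos z).ne'
      simp
      field_simp))
  obtain ⟨k₀₀, k₀₁, -, k₁₁⟩ := hj.pd_pd_eq
  rw [k₀₀, k₀₁, k₁₁, hv, hv]
  have h₁ := pd_logRho hf hc z 0
  rw [hv, mul_zero] at h₁
  have h₂ := (hasJet_detHess hf z).pd_pd_eq.1
  rw [funext (pd_eq_zero_of_const (detHess_eq_of_affineMaximal hf hc hpde) 0),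
    pd_eq_zero_of_const (fun _ => rfl)] at h₂
  have s₁ : pd 1 (pd 0 (pd 0 f)) = pd 0 (pd 0 (pd 1 f)) := by
    rw [pd_pd_comm (contDiff_pd hf 0) 1 0, pd_pd_comm hf 1 0]
  have s₂ : pd 1 (pd 1 (pd 0 (pd 0 f))) = pd 0 (pd 0 (pd 1 (pd 1 f))) := by
    rw [s₁, pd_pd_comm (contDiff_pd (contDiff_pd hf 1) 0) 1 0,
      pd_pd_comm (contDiff_pd hf 1) 1 0]
  rw [s₂, s₁]
  have hi := inv_mul_cancel₀ (hpos z).ne'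
  rw [← inv_pow]
  generalize (pd 0 (pd 0 f) z)⁻¹ = i at hi
  linear_combination i ^ 2 * h₂ + 2 * i ^ 3 * pd 0 (pd 0 (pd 0 f)) z * h₁ -
    2 * i ^ 2 * (pd 0 (pd 0 (pd 0 f)) z * pd 0 (pd 1 (pd 1 f)) z -
      pd 0 (pd 0 (pd 1 f)) z ^ 2) * hi

end AffineMaximal

theorem eq_of_hasJet_zero {φ : (Fin 2 → ℝ) → ℝ} {a b c : (Fin 2 → ℝ) → ℝ}
    (h : ∀ y, HasJet φ y 0 0 (a y) (b y) (c y)) (y : Fin 2 → ℝ) : φ y = φ 0 := by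
  refine is_const_of_fderiv_eq_zero (𝕜 := ℝ) (fun y => (h y).hasFDerivAt.differentiableAt)
    (fun y => ?_) y 0
  rw [(h y).hasFDerivAt.fderiv]
  ext u
  simp

theorem eq_of_pd_eq_zero {φ : (Fin 2 → ℝ) → ℝ} (hφ : ContDiff ℝ (⊤ : ℕ∞) φ)
    (h : ∀ i y, pd i φ y = 0) (y : Fin 2 → ℝ) : φ y = φ 0 :=
  eq_of_hasJet_zero (fun y => (hasJet_of_contDiff hφ y).congr_jet (h 0 y) (h 1 y) rfl rfl rfl) y

/-- A smooth function on `ℝ²` with constant second derivatives is a quadratic polynomial. -/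
theorem isQuadratic_of_hess_const {f : (Fin 2 → ℝ) → ℝ} (hf : ContDiff ℝ (⊤ : ℕ∞) f)
    (h : ∀ i j y, pd i (pd j f) y = pd i (pd j f) 0) : IsQuadratic f := by
  have hp : ∀ j y, pd j f y = pd 0 (pd j f) 0 * y 0 + pd 1 (pd j f) 0 * y 1 + pd j f 0 := by
    intro j y
    have := eq_of_hasJet_zero (fun y => ((hasJet_of_contDiff (contDiff_pd hf j) y).add
      (.affine (-pd 0 (pd j f) 0) (-pd 1 (pd j f) 0) 0 y)).congr_jet (by rw [h]; ring)
      (by rw [h]; ring) rfl rfl rfl) y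
    simp only [Pi.zero_apply] at this
    linarith
  have hq := eq_of_hasJet_zero (fun y => (((hasJet_of_contDiff hf y).add
    ((((HasJet.affine 1 0 0 y).mul (.affine (pd 0 (pd 0 f) 0) (pd 0 (pd 1 f) 0) 0 y)).add
      ((HasJet.affine 0 1 0 y).mul
        (.affine (pd 0 (pd 1 f) 0) (pd 1 (pd 1 f) 0) 0 y))).const_mul (-1 / 2))).add
      (.affine (-pd 0 f 0) (-pd 1 f 0) 0 y)).congr_jet
      (by rw [hp, pd_pd_comm hf 1 0]; ring) (by rw [hp]; ring) rfl rfl rfl)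
  refine ⟨Matrix.of fun i j => 1 / 2 * pd i (pd j f) 0, fun i => pd i f 0, f 0, fun y => ?_⟩
  have := hq y
  simp only [Pi.zero_apply] at this
  simp only [Fin.sum_univ_two, Matrix.of_apply, pd_pd_comm hf 1 0]
  linarith

/-- Chern's affine Bernstein conjecture for `n = 2`. A smooth, strictly convex
solution of the affine maximal surface equation (`w = (det D²f)^{-3/4}`) on all of `ℝ²`
is a quadratic polynomial. -/
theorem statement1 (f : (Fin 2 → ℝ) → ℝ)
    (hsmooth : ContDiff ℝ (⊤ : ℕ∞) f)
    (hconv : ∀ x, (hess f x).PosDef)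
    (hpde : PDE1 f (-3/4) Set.univ) :
    IsQuadratic f := by
  have hr := pd_pd_self_eq_of_affineMaximal hsmooth hconv hpde
  have hv := fun i => pd_eq_zero_of_const (logRho_eq_of_affineMaximal hsmooth hconv hpde) i
  have hpos := pd_pd_self_pos hconv
  have a0 : ∀ z, pd 0 (pd 0 (pd 0 f)) z = 0 := pd_eq_zero_of_const hr 0
  have b0 : ∀ z, pd 0 (pd 0 (pd 1 f)) z = 0 := by
    rw [← pd_pd_comm hsmooth 1 0, ← pd_pd_comm (contDiff_pd hsmooth 0) 1 0]
    exact pd_eq_zero_of_const hr 1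
  have c0 : ∀ z, pd 0 (pd 1 (pd 1 f)) z = 0 := fun z => by
    have h := pd_logRho hsmooth hconv z 0
    rw [hv, a0, b0] at h
    exact (mul_eq_zero.1 (by linarith : pd 0 (pd 0 f) z * _ = 0)).resolve_left (hpos z).ne'
  have e0 : ∀ z, pd 1 (pd 1 (pd 1 f)) z = 0 := fun z => by
    have h := pd_one_logRho hsmooth hconv z
    rw [hv, b0, c0] at h
    exact (mul_eq_zero.1 (by linarith : pd 0 (pd 0 f) z * _ = 0)).resolve_left (hpos z).ne'
  have hsm := fun i j => contDiff_pd (contDiff_pd hsmooth j) i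
  have h01 : ∀ y, pd 0 (pd 1 f) y = pd 0 (pd 1 f) 0 := by
    refine eq_of_pd_eq_zero (hsm 0 1) fun i y => ?_
    fin_cases i
    · exact b0 y
    · have := c0 y
      rwa [pd_pd_comm (contDiff_pd hsmooth 1) 0 1] at this
  have h11 : ∀ y, pd 1 (pd 1 f) y = pd 1 (pd 1 f) 0 := by
    refine eq_of_pd_eq_zero (hsm 1 1) fun i y => ?_
    fin_cases i
    · exact c0 y
    · exact e0 y
  refine isQuadratic_of_hess_const hsmooth fun i j => ?_
  fin_cases i <;> fin_cases j
  · exact hr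
  · exact h01
  · exact (pd_pd_comm hsmooth 1 0).symm ▸ h01
  · exact h11
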